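/- Let R₁, ..., Rₙ be rings and R = R₁ × ... × Rₙ. The cyclic submodule R((a₁,...,aₙ), (b₁,...,bₙ)) of R² is free if and only if each Rᵢ(aᵢ, bᵢ) is a free cyclic submodule of Rᵢ². -/

import Mathlib

/-- In a direct product of rings, `R(a, b)` is free iff each `Rᵢ(aᵢ, bᵢ)` is free. -/
theorem stmt_13 {n : ℕ} (R : Fin n → Type*) [∀ i, Ring (R i)]
    (a b : ∀ i, R i) :
    (∀ r : ∀ i, R i, r * a = 0 → r * b = 0 → r = 0) ↔
      ∀ i, ∀ r : R i, r * a i = 0 → r * b i = 0 → r = 0 := by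
  constructor
  · intro h i r ha hb
    have single_mul_eq_zero (c : ∀ j, R j) (hc : r * c i = 0) : Pi.single i r * c = 0 := by
      rw [← Pi.single_mul_left, hc, Pi.single_zero]
    exact Pi.single_eq_zero_iff.mp
      (h (Pi.single i r) (single_mul_eq_zero a ha) (single_mul_eq_zero b hb))
  · intro h r ha hb
    funext i
    exact h i (r i) (congrFun ha i) (congrFun hb i)
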